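/- For all τ ∈ ℂ with Im τ > 0, θ'[1/4; 1/4](0,τ) · θ[1/4; 1/4](0,τ)³ = −(π/4) · θ[0; 0](0,τ)⁴ · θ[0; 1/2](0,τ) · θ[1/2; 0](0,τ), where in [ε'; ε] the first entry is the top characteristic ε' and the second is the bottom characteristic ε. -/

import Mathlib

open Complex

/-- The theta function with characteristic `[ε'; ε]`:
`θ[ε';ε](z,τ) = Σ_{n∈ℤ} exp(πi(n+ε')²τ + 2πi(n+ε')(z+ε))`. -/
noncomputable def jacobiThetaChar (ε' ε : ℝ) (z τ : ℂ) : ℂ :=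
  ∑' n : ℤ, Complex.exp ((Real.pi : ℂ) * Complex.I * ((n : ℂ) + (ε' : ℂ)) ^ 2 * τ +
    2 * (Real.pi : ℂ) * Complex.I * ((n : ℂ) + (ε' : ℂ)) * (z + (ε : ℂ)))

/-- The theta derivative `θ'[ε';ε](0,τ) = ∂_z θ[ε';ε](z,τ) |_{z=0}`. -/
noncomputable def jacobiThetaCharDeriv (ε' ε : ℝ) (τ : ℂ) : ℂ :=
  deriv (fun z => jacobiThetaChar ε' ε z τ) 0

namespace ThetaQ

lemma lattice_split (h : ℤ × ℤ → ℂ) (hs : Summable h) :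
    ∑' x, h x = ∑' x : ℤ × ℤ, h (x.1 + x.2, x.1 - x.2)
      + ∑' x : ℤ × ℤ, h (x.1 + x.2 + 1, x.1 - x.2) := by
  let e : (ℤ × ℤ) ⊕ (ℤ × ℤ) → ℤ × ℤ := Sum.elim (fun x => (x.1 + x.2, x.1 - x.2))
    (fun x => (x.1 + x.2 + 1, x.1 - x.2))
  have he : Function.Bijective e := by
    constructor
    · rintro (⟨a, b⟩ | ⟨a, b⟩) (⟨c, d⟩ | ⟨c, d⟩) hh <;>
        simp only [e, Sum.elim_inl, Sum.elim_inr, Prod.mk.injEq] at hh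
      · congr 2 <;> omega
      · omega
      · omega
      · congr 2 <;> omega
    · rintro ⟨n, m⟩
      rcases Int.even_or_odd' (n + m) with ⟨k, hk | hk⟩
      · exact ⟨Sum.inl (k, n - k), by simp only [e, Sum.elim_inl, Prod.mk.injEq]; omega⟩
      · exact ⟨Sum.inr (k, n - 1 - k), by simp only [e, Sum.elim_inr, Prod.mk.injEq]; omega⟩
  have h1 := (Equiv.ofBijective e he).tsum_eq h
  have hs' : Summable (h ∘ e) := (Equiv.ofBijective e he).summable_iff.mpr hs
  rw [← h1]
  have := Summable.tsum_sum (f := h ∘ e) (hs'.comp_injective Sum.inl_injective)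
    (hs'.comp_injective Sum.inr_injective)
  exact this

lemma prod_split {f g u v u' v' : ℤ → ℂ} (hf : Summable f) (hg : Summable g)
    (hu : Summable u) (hv : Summable v) (hu' : Summable u') (hv' : Summable v')
    (h1 : ∀ a b, f (a + b) * g (a - b) = u a * v b)
    (h2 : ∀ a b, f (a + b + 1) * g (a - b) = u' a * v' b) :
    (∑' n, f n) * (∑' n, g n) = (∑' n, u n) * (∑' n, v n) + (∑' n, u' n) * (∑' n, v' n) := by
  rw [tsum_mul_tsum_of_summable_norm hf.norm hg.norm, tsum_mul_tsum_of_summable_norm hu.norm hv.norm,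
    tsum_mul_tsum_of_summable_norm hu'.norm hv'.norm,
    lattice_split _ (summable_mul_of_summable_norm hf.norm hg.norm)]
  simp only [h1, h2]

lemma prod_split_symm {f g u v u' v' : ℤ → ℂ} (hf : Summable f) (hg : Summable g)
    (hu : Summable u) (hv : Summable v) (hu' : Summable u') (hv' : Summable v')
    (h1 : ∀ a b, f (a + b) * g (a - b) + g (a + b) * f (a - b) = 2 * (u a * v b))
    (h2 : ∀ a b, f (a + b + 1) * g (a - b) + g (a + b + 1) * f (a - b) = 2 * (u' a * v' b)) :
    (∑' n, f n) * (∑' n, g n) = (∑' n, u n) * (∑' n, v n) + (∑' n, u' n) * (∑' n, v' n) := by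
  have s1 := summable_mul_of_summable_norm hf.norm hg.norm
  have s2 := summable_mul_of_summable_norm hg.norm hf.norm
  have key : 2 * ((∑' n, f n) * (∑' n, g n)) =
      2 * ((∑' n, u n) * (∑' n, v n) + (∑' n, u' n) * (∑' n, v' n)) := by
    rw [two_mul]
    nth_rewrite 2 [mul_comm]
    rw [tsum_mul_tsum_of_summable_norm hf.norm hg.norm, tsum_mul_tsum_of_summable_norm hg.norm hf.norm,
      tsum_mul_tsum_of_summable_norm hu.norm hv.norm,
      tsum_mul_tsum_of_summable_norm hu'.norm hv'.norm, ← s1.tsum_add s2,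
      lattice_split _ (s1.add s2)]
    simp only [h1, h2]
    rw [tsum_mul_left, tsum_mul_left, mul_add]
  exact mul_left_cancel₀ two_ne_zero key

lemma summable_aux {r : ℝ} (h0 : 0 ≤ r) (h1 : r < 1) :
    Summable (fun n : ℤ => (4 * |(n:ℝ)| + 1) * r ^ n.natAbs) := by
  have h1' : ‖r‖ < 1 := by rwa [Real.norm_of_nonneg h0]
  have a := summable_pow_mul_geometric_of_norm_lt_one 1 h1'
  have b := summable_geometric_of_norm_lt_one h1'
  have c : Summable (fun n : ℕ => (4 * (n:ℝ) + 1) * r ^ n) := by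
    refine ((a.mul_left 4).add b).congr fun n => ?_
    ring
  apply Summable.of_nat_of_neg
  · simpa using c
  · simpa using c

lemma summable_gen {q : ℂ} (hq0 : q ≠ 0) (hq : ‖q‖ < 1) {c : ℤ → ℂ} {e : ℤ → ℤ}
    (hc : ∀ n, ‖c n‖ ≤ 4 * |(n:ℝ)| + 1) (he : ∀ n, |n| ≤ e n) :
    Summable (fun n => c n * q ^ e n) := by
  refine Summable.of_norm_bounded (summable_aux (norm_nonneg q) hq) fun n => ?_
  rw [norm_mul, norm_zpow]
  refine mul_le_mul (hc n) ?_ (by positivity) (by positivity)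
  rw [← zpow_natCast]
  exact zpow_le_zpow_right_of_le_one₀ (norm_pos_iff.mpr hq0) hq.le (by simpa using he n)

lemma tendsto_gen {q : ℂ} (hq0 : q ≠ 0) (hq : ‖q‖ < 1) {c : ℤ → ℂ} {e : ℤ → ℤ}
    (hc : ∀ n, ‖c n‖ ≤ 4 * |(n:ℝ)| + 1) (he : ∀ n, |n| ≤ e n) (he0 : e 0 = 0) :
    Filter.Tendsto (fun k : ℕ => ∑' n, c n * (q ^ (2 ^ k)) ^ e n) Filter.atTop (nhds (c 0)) := by
  have : c 0 = ∑' n : ℤ, if n = 0 then c 0 else 0 := by simp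
  rw [this]
  refine tendsto_tsum_of_dominated_convergence (summable_aux (norm_nonneg q) hq) ?_ ?_
  · intro n
    split_ifs with h
    · subst h; simp [he0]
    · have hpos : 0 < e n := lt_of_lt_of_le (abs_pos.mpr h) (he n)
      obtain ⟨m, hm⟩ := Int.eq_ofNat_of_zero_le hpos.le
      have hm0 : m ≠ 0 := by rintro rfl; simp [hm] at hpos
      have : Filter.Tendsto (fun k : ℕ => (q ^ m) ^ (2 ^ k)) Filter.atTop (nhds 0) := by
        refine (tendsto_pow_atTop_nhds_zero_of_norm_lt_one ?_).comp
          (tendsto_pow_atTop_atTop_of_one_lt (by norm_num : 1 < 2))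
        rw [norm_pow]; exact pow_lt_one₀ (norm_nonneg _) hq hm0
      rw [hm]
      have h2 := this.const_mul (c n)
      rw [mul_zero] at h2
      refine h2.congr fun k => ?_
      simp only [zpow_natCast]
      rw [← pow_mul, ← pow_mul, mul_comm m]
  · refine Filter.Eventually.of_forall fun k n => ?_
    rw [norm_mul]
    refine mul_le_mul (hc n) ?_ (by positivity) (by positivity)
    rw [norm_zpow, norm_pow, ← zpow_natCast (‖q‖) n.natAbs, ← zpow_natCast (‖q‖), ← zpow_mul]
    refine zpow_le_zpow_right_of_le_one₀ (norm_pos_iff.mpr hq0) hq.le ?_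
    have h1 := he n
    have h3 : (1:ℤ) ≤ ((2 ^ k : ℕ) : ℤ) := by exact_mod_cast Nat.one_le_two_pow
    have h4 := abs_nonneg n
    rw [Int.natCast_natAbs]
    nlinarith

/-- `Σ ω^n q^{2n²+n}` -/
noncomputable def P (ω q : ℂ) : ℂ := ∑' n : ℤ, ω ^ n * q ^ (2 * n ^ 2 + n)
/-- `Σ (4n+1) ω^n q^{2n²+n}` -/
noncomputable def E (ω q : ℂ) : ℂ := ∑' n : ℤ, (4 * (n:ℂ) + 1) * ω ^ n * q ^ (2 * n ^ 2 + n)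
/-- even part of `φ` -/
noncomputable def Fe (q : ℂ) : ℂ := ∑' n : ℤ, q ^ ((2 * n) ^ 2)
/-- odd part of `φ` -/
noncomputable def Fo (q : ℂ) : ℂ := ∑' n : ℤ, q ^ ((2 * n + 1) ^ 2)
/-- `Σ q^{n²}` -/
noncomputable def F (q : ℂ) : ℂ := ∑' n : ℤ, q ^ (n ^ 2)

lemma abs_le_sq' (n : ℤ) : |n| ≤ n ^ 2 := by
  rw [← sq_abs]
  rcases eq_or_ne n 0 with rfl | h
  · simp
  · have : 1 ≤ |n| := Int.one_le_abs h
    nlinarith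

lemma e1 (n : ℤ) : |n| ≤ 2 * n ^ 2 + n := by
  have := abs_le_sq' n
  have h2 : -n ≤ n ^ 2 := (neg_le_abs n).trans this
  have h3 := sq_nonneg n
  rcases abs_cases n with ⟨h, _⟩ | ⟨h, _⟩ <;> rw [h] <;> linarith

lemma e2 (n : ℤ) : |n| ≤ (2 * n) ^ 2 := by nlinarith [abs_le_sq' n, sq_nonneg n]

lemma e3 (n : ℤ) : |n| ≤ (2 * n + 1) ^ 2 := by
  have := e1 n
  have h0 := abs_nonneg n
  nlinarith [e1 n, abs_le_sq' n]

lemma c1 (n : ℤ) : ‖(1 : ℂ)‖ ≤ 4 * |(n:ℝ)| + 1 := by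
  simp
lemma cω {ω : ℂ} (hω : ‖ω‖ = 1) (n : ℤ) : ‖ω ^ n‖ ≤ 4 * |(n:ℝ)| + 1 := by
  simp [norm_zpow, hω]
lemma cE {ω : ℂ} (hω : ‖ω‖ = 1) (n : ℤ) : ‖(4 * (n:ℂ) + 1) * ω ^ n‖ ≤ 4 * |(n:ℝ)| + 1 := by
  rw [norm_mul, norm_zpow, hω, one_zpow, mul_one]
  refine (norm_add_le _ _).trans ?_
  simp

variable {q ω : ℂ}

lemma sP (hω : ‖ω‖ = 1) (hq0 : q ≠ 0) (hq : ‖q‖ < 1) :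
    Summable (fun n : ℤ => ω ^ n * q ^ (2 * n ^ 2 + n)) := summable_gen hq0 hq (cω hω) e1
lemma sE (hω : ‖ω‖ = 1) (hq0 : q ≠ 0) (hq : ‖q‖ < 1) :
    Summable (fun n : ℤ => (4 * (n:ℂ) + 1) * ω ^ n * q ^ (2 * n ^ 2 + n)) :=
  summable_gen hq0 hq (cE hω) e1
lemma sFe (hq0 : q ≠ 0) (hq : ‖q‖ < 1) : Summable (fun n : ℤ => q ^ ((2 * n) ^ 2)) := by
  simpa using summable_gen hq0 hq c1 e2
lemma sFo (hq0 : q ≠ 0) (hq : ‖q‖ < 1) : Summable (fun n : ℤ => q ^ ((2 * n + 1) ^ 2)) := by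
  simpa using summable_gen hq0 hq c1 e3
lemma sF (hq0 : q ≠ 0) (hq : ‖q‖ < 1) : Summable (fun n : ℤ => q ^ (n ^ 2)) := by
  simpa using summable_gen hq0 hq c1 abs_le_sq'

lemma tsum_even_odd {f : ℤ → ℂ} (hf : Summable f) :
    ∑' n, f n = ∑' n, f (2 * n) + ∑' n, f (2 * n + 1) := by
  have h1 : Function.Injective (fun n : ℤ => 2 * n) := fun a b h => by simpa using h
  have h2 : Function.Injective (fun n : ℤ => 2 * n + 1) := fun a b h => by simpa using h
  let e : ℤ ⊕ ℤ → ℤ := Sum.elim (fun n => 2 * n) (fun n => 2 * n + 1)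
  have he : Function.Bijective e := by
    constructor
    · rintro (a | a) (b | b) hh <;> simp only [e, Sum.elim_inl, Sum.elim_inr] at hh
      · congr 1; omega
      · omega
      · omega
      · congr 1; omega
    · intro n
      rcases Int.even_or_odd' n with ⟨k, hk | hk⟩
      · exact ⟨Sum.inl k, hk.symm⟩
      · exact ⟨Sum.inr k, hk.symm⟩
  rw [← (Equiv.ofBijective e he).tsum_eq f]
  exact Summable.tsum_sum (f := f ∘ e) (hf.comp_injective h1) (hf.comp_injective h2)

lemma F_eq (hq0 : q ≠ 0) (hq : ‖q‖ < 1) : F q = Fe q + Fo q := tsum_even_odd (sF hq0 hq)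

lemma F_neg (hq0 : q ≠ 0) (hq : ‖q‖ < 1) : F (-q) = Fe q - Fo q := by
  rw [F_eq (neg_ne_zero.mpr hq0) (by simpa using hq), Fe, Fe, Fo, Fo, sub_eq_add_neg, ← tsum_neg]
  congr 1
  · refine tsum_congr fun n => ?_
    rw [Even.neg_zpow]
    exact ⟨2 * n ^ 2, by ring⟩
  · refine tsum_congr fun n => ?_
    rw [Odd.neg_zpow]
    exact ⟨2 * n ^ 2 + 2 * n, by ring⟩

lemma reflect (f : ℤ → ℂ) : ∑' n, f (-n - 1) = ∑' n, f n := by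
  have := (Equiv.subLeft (-1 : ℤ)).tsum_eq f
  rw [← this]
  refine tsum_congr fun n => ?_
  congr 1
  simp; ring

lemma omega_aux (hω : ω ^ 4 = 1) (c : ℤ) : ω ^ (2 * (-c - 1) + 1) = ω⁻¹ * (ω ^ 2) ^ c := by
  have h0 : ω ≠ 0 := by rintro rfl; simp at hω
  have : ω ^ (2 * (-c - 1) + 1) = ω⁻¹ * (ω ^ 2) ^ c * ((ω ^ 4) ^ c)⁻¹ := by
    rw [← zpow_natCast, ← zpow_natCast, ← zpow_mul, ← zpow_mul, ← zpow_neg, ← zpow_neg_one,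
      ← zpow_add₀ h0, ← zpow_add₀ h0]
    congr 1; push_cast; ring
  rw [this, hω]; simp

lemma PP (hω : ω ^ 4 = 1) (hq0 : q ≠ 0) (hq : ‖q‖ < 1) :
    P ω q * P ω q = P (ω ^ 2) (q ^ 2) * (Fe q + ω⁻¹ * Fo q) := by
  have h0 : ω ≠ 0 := by rintro rfl; simp at hω
  have hn : ‖ω‖ = 1 := by
    have := congrArg norm hω
    rw [norm_pow, norm_one] at this
    exact (pow_eq_one_iff_of_nonneg (norm_nonneg _) (by norm_num)).mp this
  have hn2 : ‖ω ^ 2‖ = 1 := by rw [norm_pow, hn, one_pow]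
  have hq2 : ‖q ^ 2‖ < 1 := by rw [norm_pow]; exact pow_lt_one₀ (norm_nonneg _) hq (by norm_num)
  have hq20 : q ^ 2 ≠ 0 := pow_ne_zero 2 hq0
  set u' : ℤ → ℂ := fun a => ω ^ (2 * a + 1) * q ^ ((2 * a + 1) * (2 * a + 2)) with hu'
  have hu'r : ∀ c : ℤ, u' (-c - 1) = ω⁻¹ * ((ω ^ 2) ^ c * (q ^ 2) ^ (2 * c ^ 2 + c)) := by
    intro c
    rw [hu']; simp only
    rw [omega_aux hω, mul_assoc]
    congr 2
    rw [← zpow_natCast q 2, ← zpow_mul]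
    congr 1; push_cast; ring
  have su : Summable u' := by
    have : Summable (u' ∘ (Equiv.subLeft (-1 : ℤ))) := by
      refine ((sP hn2 hq20 hq2).mul_left ω⁻¹).congr fun c => ?_
      rw [← hu'r]; simp only [Function.comp, Equiv.subLeft_apply]; congr 1; ring
    exact (Equiv.summable_iff _).mp this
  have := prod_split (sP hn hq0 hq) (sP hn hq0 hq) (sP hn2 hq20 hq2) (sFe hq0 hq)
    su (sFo hq0 hq) ?_ ?_
  · rw [← reflect u'] at this
    simp only [hu'r] at this
    rw [tsum_mul_left] at this
    unfold P Fe Fo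
    rw [this]; ring
  · intro a b
    rw [← zpow_natCast q 2, ← zpow_natCast ω 2, ← zpow_mul, ← zpow_mul, mul_mul_mul_comm,
      ← zpow_add₀ h0, ← zpow_add₀ hq0, mul_assoc, ← zpow_add₀ hq0]
    congr 2 <;> push_cast <;> ring
  · intro a b
    simp only [hu']
    rw [mul_mul_mul_comm,
      ← zpow_add₀ h0, ← zpow_add₀ hq0, mul_assoc, ← zpow_add₀ hq0]
    congr 2 <;> ring

lemma EP (hω : ω ^ 4 = 1) (hq0 : q ≠ 0) (hq : ‖q‖ < 1) :
    E ω q * P ω q = E (ω ^ 2) (q ^ 2) * (Fe q - ω⁻¹ * Fo q) := by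
  have h0 : ω ≠ 0 := by rintro rfl; simp at hω
  have hn : ‖ω‖ = 1 := by
    have := congrArg norm hω
    rw [norm_pow, norm_one] at this
    exact (pow_eq_one_iff_of_nonneg (norm_nonneg _) (by norm_num)).mp this
  have hn2 : ‖ω ^ 2‖ = 1 := by rw [norm_pow, hn, one_pow]
  have hq2 : ‖q ^ 2‖ < 1 := by rw [norm_pow]; exact pow_lt_one₀ (norm_nonneg _) hq (by norm_num)
  have hq20 : q ^ 2 ≠ 0 := pow_ne_zero 2 hq0
  set u' : ℤ → ℂ := fun a => (4 * (a : ℂ) + 3) * (ω ^ (2 * a + 1) * q ^ ((2 * a + 1) * (2 * a + 2)))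
    with hu'
  have hu'r : ∀ c : ℤ, u' (-c - 1) =
      -ω⁻¹ * ((4 * (c : ℂ) + 1) * (ω ^ 2) ^ c * (q ^ 2) ^ (2 * c ^ 2 + c)) := by
    intro c
    rw [hu']; simp only
    rw [omega_aux hω]
    have : q ^ ((2 * (-c - 1) + 1) * (2 * (-c - 1) + 2)) = (q ^ 2) ^ (2 * c ^ 2 + c) := by
      rw [← zpow_natCast q 2, ← zpow_mul]
      congr 1; push_cast; ring
    rw [this]; push_cast; ring
  have su : Summable u' := by
    have : Summable (u' ∘ (Equiv.subLeft (-1 : ℤ))) := by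
      refine ((sE hn2 hq20 hq2).mul_left (-ω⁻¹)).congr fun c => ?_
      rw [← hu'r]; simp only [Function.comp, Equiv.subLeft_apply]; congr 1; ring
    exact (Equiv.summable_iff _).mp this
  have := prod_split_symm (sE hn hq0 hq) (sP hn hq0 hq) (sE hn2 hq20 hq2) (sFe hq0 hq)
    su (sFo hq0 hq) ?_ ?_
  · rw [← reflect u'] at this
    simp only [hu'r] at this
    rw [tsum_mul_left] at this
    unfold E P Fe Fo
    rw [this]; ring
  · intro a b
    have k1 : ω ^ (a + b) * ω ^ (a - b) = (ω ^ 2) ^ a := by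
      rw [← zpow_natCast ω 2, ← zpow_mul, ← zpow_add₀ h0]; congr 1; push_cast; ring
    have k2 : q ^ (2 * (a + b) ^ 2 + (a + b)) * q ^ (2 * (a - b) ^ 2 + (a - b)) =
        (q ^ 2) ^ (2 * a ^ 2 + a) * q ^ ((2 * b) ^ 2) := by
      rw [← zpow_natCast q 2, ← zpow_mul, ← zpow_add₀ hq0, ← zpow_add₀ hq0]
      congr 1; push_cast; ring
    push_cast
    linear_combination (8 * (a:ℂ) + 2) * q ^ (2 * (a + b) ^ 2 + (a + b)) *
      q ^ (2 * (a - b) ^ 2 + (a - b)) * k1 + (8 * (a:ℂ) + 2) * (ω ^ 2) ^ a * k2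
  · intro a b
    have k1 : ω ^ (a + b + 1) * ω ^ (a - b) = ω ^ (2 * a + 1) := by
      rw [← zpow_add₀ h0]; congr 1; ring
    have k2 : q ^ (2 * (a + b + 1) ^ 2 + (a + b + 1)) * q ^ (2 * (a - b) ^ 2 + (a - b)) =
        q ^ ((2 * a + 1) * (2 * a + 2)) * q ^ ((2 * b + 1) ^ 2) := by
      rw [← zpow_add₀ hq0, ← zpow_add₀ hq0]
      congr 1; ring
    simp only [hu']
    push_cast
    linear_combination (8 * (a:ℂ) + 6) * q ^ (2 * (a + b + 1) ^ 2 + (a + b + 1)) *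
      q ^ (2 * (a - b) ^ 2 + (a - b)) * k1 + (8 * (a:ℂ) + 6) * ω ^ (2 * a + 1) * k2

lemma sum_sq (hq0 : q ≠ 0) (hq : ‖q‖ < 1) : Fe q ^ 2 + Fo q ^ 2 = F (q ^ 2) ^ 2 := by
  have hq2 : ‖q ^ 2‖ < 1 := by rw [norm_pow]; exact pow_lt_one₀ (norm_nonneg _) hq (by norm_num)
  have hq20 : q ^ 2 ≠ 0 := pow_ne_zero 2 hq0
  have := prod_split (sF hq20 hq2) (sF hq20 hq2) (sFe hq0 hq) (sFe hq0 hq) (sFo hq0 hq) (sFo hq0 hq)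
    ?_ ?_
  · rw [pow_two, pow_two, pow_two (F _)]
    exact this.symm
  · intro a b
    rw [← zpow_natCast q 2, ← zpow_mul, ← zpow_mul, ← zpow_add₀ hq0, ← zpow_add₀ hq0]
    congr 1; push_cast; ring
  · intro a b
    rw [← zpow_natCast q 2, ← zpow_mul, ← zpow_mul, ← zpow_add₀ hq0, ← zpow_add₀ hq0]
    congr 1; push_cast; ring

lemma neg_one_zpow_sq (n : ℤ) : (-1 : ℂ) ^ (n ^ 2) = (-1) ^ n := by
  rcases Int.even_or_odd n with h | h
  · rw [h.neg_one_zpow, Even.neg_one_zpow]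
    exact h.pow_of_ne_zero two_ne_zero
  · rw [h.neg_one_zpow, Odd.neg_one_zpow]
    exact h.pow

lemma F_neg' (q : ℂ) : F (-q) = ∑' n : ℤ, (-1) ^ n * q ^ (n ^ 2) := by
  refine tsum_congr fun n => ?_
  rw [← neg_one_mul, mul_zpow, neg_one_zpow_sq]

lemma neg_one_zpow_tri (n : ℤ) : (-1 : ℂ) ^ (2 * n ^ 2 + n) = (-1) ^ n := by
  rw [zpow_add₀ (by norm_num), Even.neg_one_zpow ⟨n ^ 2, by ring⟩, one_mul]

lemma P_neg (q : ℂ) : P (-1) q = P 1 (-q) := by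
  refine tsum_congr fun n => ?_
  rw [← neg_one_mul q, mul_zpow, neg_one_zpow_tri, one_zpow, one_mul]

lemma E_neg (q : ℂ) : E (-1) q = E 1 (-q) := by
  refine tsum_congr fun n => ?_
  rw [← neg_one_mul q, mul_zpow, neg_one_zpow_tri, one_zpow]; ring

lemma nm1 : ‖(-1 : ℂ)‖ = 1 := by simp

lemma e4 (n : ℤ) : |n| ≤ n ^ 2 + n + 1 := by
  rcases abs_cases n with ⟨h, _⟩ | ⟨h, _⟩ <;> rw [h] <;> nlinarith [sq_nonneg (n + 1), sq_nonneg n]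

lemma FF (hq0 : q ≠ 0) (hq : ‖q‖ < 1) : F q * F (-q) = F (-q ^ 2) ^ 2 := by
  have hq2 : ‖q ^ 2‖ < 1 := by rw [norm_pow]; exact pow_lt_one₀ (norm_nonneg _) hq (by norm_num)
  have hq20 : q ^ 2 ≠ 0 := pow_ne_zero 2 hq0
  have hm : (-1 : ℂ) ≠ 0 := by norm_num
  set v : ℤ → ℂ := fun n => (-1) ^ n * (q ^ 2) ^ (n ^ 2 + n + 1) with hv
  have sv : Summable v := summable_gen hq20 hq2 (cω nm1) e4
  have hv0 : ∑' n, v n = 0 := by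
    have h1 := reflect v
    have h2 : ∀ n : ℤ, v (-n - 1) = - v n := by
      intro n
      simp only [hv]
      have a1 : (-1 : ℂ) ^ (-n - 1) = - (-1) ^ n := by
        rcases Int.even_or_odd n with h | h
        · rw [h.neg_one_zpow, Odd.neg_one_zpow]
          obtain ⟨k, rfl⟩ := h; exact ⟨-k - 1, by ring⟩
        · rw [h.neg_one_zpow, Even.neg_one_zpow]; · simp
          obtain ⟨k, rfl⟩ := h; exact ⟨-k - 1, by ring⟩
      have a2 : (-n - 1) ^ 2 + (-n - 1) + 1 = n ^ 2 + n + 1 := by ring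
      rw [a1, a2]; ring
    simp only [h2] at h1
    rw [tsum_neg] at h1
    linear_combination (-1 / 2 : ℂ) * h1
  have sg := summable_gen hq0 hq (cω nm1) abs_le_sq'
  have sg2 := summable_gen hq20 hq2 (cω nm1) abs_le_sq'
  have hsgn : ∀ a b : ℤ, (-1 : ℂ) ^ (a - b) = (-1) ^ a * (-1) ^ b := by
    intro a b
    rw [zpow_sub₀ hm]
    rcases Int.even_or_odd b with h | h <;> rw [h.neg_one_zpow] <;> simp [div_neg]
  have := prod_split (sF hq0 hq) sg sg2 sg2 (sv.mul_left (q ^ (-3 : ℤ))) sv ?_ ?_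
  · rw [hv0, mul_zero, add_zero] at this
    rw [pow_two (F _), F_neg', F_neg', F]
    exact this
  · intro a b
    have k2 : q ^ ((a + b) ^ 2) * q ^ ((a - b) ^ 2) = (q ^ 2) ^ (a ^ 2) * (q ^ 2) ^ (b ^ 2) := by
      rw [← zpow_natCast q 2, ← zpow_mul, ← zpow_mul, ← zpow_add₀ hq0, ← zpow_add₀ hq0]
      congr 1; push_cast; ring
    rw [hsgn]
    linear_combination (-1) ^ a * (-1) ^ b * k2
  · intro a b
    have k2 : q ^ ((a + b + 1) ^ 2) * q ^ ((a - b) ^ 2) =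
        q ^ (-3 : ℤ) * (q ^ 2) ^ (a ^ 2 + a + 1) * (q ^ 2) ^ (b ^ 2 + b + 1) := by
      rw [← zpow_natCast q 2, ← zpow_mul, ← zpow_mul, ← zpow_add₀ hq0, ← zpow_add₀ hq0,
        ← zpow_add₀ hq0]
      congr 1; push_cast; ring
    simp only [hv]
    rw [hsgn]
    linear_combination (-1) ^ a * (-1) ^ b * k2

lemma pow_ok (hq0 : q ≠ 0) (hq : ‖q‖ < 1) (k : ℕ) : q ^ (2 ^ k) ≠ 0 ∧ ‖q ^ (2 ^ k)‖ < 1 :=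
  ⟨pow_ne_zero _ hq0, by
    rw [norm_pow]; exact pow_lt_one₀ (norm_nonneg _) hq (pow_ne_zero _ two_ne_zero)⟩

lemma pow_step (q : ℂ) (k : ℕ) : q ^ (2 ^ (k + 1)) = (q ^ (2 ^ k)) ^ 2 := by
  rw [← pow_mul, pow_succ]

lemma tF (hq0 : q ≠ 0) (hq : ‖q‖ < 1) :
    Filter.Tendsto (fun k : ℕ => F (-q ^ (2 ^ k))) Filter.atTop (nhds 1) := by
  have := tendsto_gen hq0 hq (cω nm1) abs_le_sq' (by simp)
  simpa [F_neg'] using this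

lemma tP (hq0 : q ≠ 0) (hq : ‖q‖ < 1) :
    Filter.Tendsto (fun k : ℕ => P 1 (q ^ (2 ^ k))) Filter.atTop (nhds 1) := by
  have := tendsto_gen hq0 hq (cω (ω := 1) (by simp)) e1 (by simp)
  simpa only [P, zpow_zero] using this

lemma tE (hq0 : q ≠ 0) (hq : ‖q‖ < 1) :
    Filter.Tendsto (fun k : ℕ => E 1 (q ^ (2 ^ k))) Filter.atTop (nhds 1) := by
  have := tendsto_gen hq0 hq (cE (ω := 1) (by simp)) e1 (by simp)
  simpa only [E, zpow_zero, Int.cast_zero, mul_zero, zero_add, mul_one] using this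

lemma F_neg_ne (hq0 : q ≠ 0) (hq : ‖q‖ < 1) : F (-q) ≠ 0 := by
  intro h
  have : ∀ k : ℕ, F (-q ^ (2 ^ k)) = 0 := by
    intro k
    induction k with
    | zero => simpa using h
    | succ k ih =>
      have := FF (pow_ok hq0 hq k).1 (pow_ok hq0 hq k).2
      rw [ih, mul_zero, ← pow_step] at this
      exact pow_eq_zero_iff two_ne_zero |>.mp this.symm
  have t := tF hq0 hq
  simp only [this] at t
  exact zero_ne_one (tendsto_nhds_unique tendsto_const_nhds t)

lemma F_ne (hq0 : q ≠ 0) (hq : ‖q‖ < 1) : F q ≠ 0 := by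
  have := F_neg_ne (neg_ne_zero.mpr hq0) (by simpa using hq)
  simpa using this

lemma PP1 (hq0 : q ≠ 0) (hq : ‖q‖ < 1) : P 1 q * P 1 q = P 1 (q ^ 2) * F q := by
  have := PP (one_pow 4) hq0 hq
  rw [F_eq hq0 hq]
  simpa using this

lemma EP1 (hq0 : q ≠ 0) (hq : ‖q‖ < 1) : E 1 q * P 1 q = E 1 (q ^ 2) * F (-q) := by
  have := EP (one_pow 4) hq0 hq
  rw [F_neg hq0 hq]
  simpa using this

lemma P_ne (hq0 : q ≠ 0) (hq : ‖q‖ < 1) : P 1 q ≠ 0 := by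
  intro h
  have : ∀ k : ℕ, P 1 (q ^ (2 ^ k)) = 0 := by
    intro k
    induction k with
    | zero => simpa using h
    | succ k ih =>
      have h2 := pow_ok hq0 hq k
      have := PP1 h2.1 h2.2
      rw [ih, mul_zero, ← pow_step] at this
      exact (mul_eq_zero.mp this.symm).resolve_right (F_ne h2.1 h2.2)
  have t := tP hq0 hq
  simp only [this] at t
  exact zero_ne_one (tendsto_nhds_unique tendsto_const_nhds t)

/-- Jacobi's derivative formula. -/
lemma jacobi (hq0 : q ≠ 0) (hq : ‖q‖ < 1) : E 1 q = F (-q) ^ 2 * P 1 q := by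
  have step : ∀ x : ℂ, x ≠ 0 → ‖x‖ < 1 →
      E 1 (x ^ 2) / (F (-x ^ 2) ^ 2 * P 1 (x ^ 2)) = E 1 x / (F (-x) ^ 2 * P 1 x) := by
    intro x h0 h1
    have h2 := pow_ok h0 h1 1
    rw [pow_one] at h2
    have n1 := F_neg_ne h0 h1
    have n2 := P_ne h0 h1
    have n3 := F_neg_ne h2.1 h2.2
    have n4 := P_ne h2.1 h2.2
    have a := FF h0 h1
    have b := PP1 h0 h1
    have c := EP1 h0 h1
    rw [div_eq_div_iff (by positivity) (by positivity), ← a]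
    linear_combination (-F (-x) * P 1 x) * c + (E 1 x * F (-x)) * b
  have const : ∀ k : ℕ, E 1 (q ^ (2 ^ k)) / (F (-q ^ (2 ^ k)) ^ 2 * P 1 (q ^ (2 ^ k))) =
      E 1 q / (F (-q) ^ 2 * P 1 q) := by
    intro k
    induction k with
    | zero => simp
    | succ k ih =>
      have h2 := pow_ok hq0 hq k
      rw [pow_step, step _ h2.1 h2.2, ih]
  have t := (tE hq0 hq).div (((tF hq0 hq).pow 2).mul (tP hq0 hq)) (by norm_num)
  have t2 : Filter.Tendsto (fun _ : ℕ => E 1 q / (F (-q) ^ 2 * P 1 q)) Filter.atTop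
      (nhds (1 / (1 ^ 2 * 1))) := t.congr const
  have := tendsto_nhds_unique tendsto_const_nhds t2
  have n1 := F_neg_ne hq0 hq
  have n2 := P_ne hq0 hq
  rw [div_eq_iff (by positivity)] at this
  simpa using this

lemma main (hq0 : q ≠ 0) (hq : ‖q‖ < 1) :
    E I q * P I q ^ 3 = F (q ^ 2) ^ 4 * F (-q ^ 2) * P 1 (q ^ 4) := by
  have h2 := pow_ok hq0 hq 1
  rw [pow_one] at h2
  have h2' : -q ^ 2 ≠ 0 ∧ ‖-q ^ 2‖ < 1 := ⟨neg_ne_zero.mpr h2.1, by simpa using h2.2⟩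
  have a := EP I_pow_four hq0 hq
  have b := PP I_pow_four hq0 hq
  rw [I_sq, inv_I] at a b
  rw [E_neg] at a
  rw [P_neg] at b
  have c := jacobi h2'.1 h2'.2
  have d := PP1 h2'.1 h2'.2
  have e := sum_sq hq0 hq
  rw [neg_neg] at c
  have : (-q ^ 2) ^ 2 = q ^ 4 := by ring
  rw [this] at d
  have hI := I_sq
  calc E I q * P I q ^ 3 = (E I q * P I q) * (P I q * P I q) := by ring
    _ = (P 1 (-q ^ 2) * P 1 (-q ^ 2)) * F (q ^ 2) ^ 2 * (Fe q ^ 2 + Fo q ^ 2) := by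
      rw [a, b, c]
      linear_combination (-(P 1 (-q ^ 2) * P 1 (-q ^ 2)) * F (q ^ 2) ^ 2 * Fo q ^ 2) * hI
    _ = _ := by rw [d, e]; ring


lemma P_tail (hq0 : q ≠ 0) (hq : ‖q‖ < 1) :
    ∑' n : ℤ, q ^ (2 * n ^ 2 + 2 * n) = 2 * P 1 (q ^ 4) := by
  have h2 := pow_ok hq0 hq 1
  rw [pow_one] at h2
  have hs : Summable (fun n : ℤ => q ^ (2 * n ^ 2 + 2 * n)) := by
    refine ((summable_gen h2.1 h2.2 c1 e4).mul_left (q ^ (-2 : ℤ))).congr fun n => ?_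
    rw [one_mul, ← zpow_natCast q 2, ← zpow_mul, ← zpow_add₀ hq0]
    congr 1; push_cast; ring
  rw [tsum_even_odd hs, ← reflect (fun n : ℤ => q ^ (2 * (2 * n + 1) ^ 2 + 2 * (2 * n + 1))), two_mul, P]
  congr 1
  · refine tsum_congr fun n => ?_
    rw [one_zpow, one_mul, ← zpow_natCast q 4, ← zpow_mul]
    congr 1; push_cast; ring
  · refine tsum_congr fun n => ?_
    rw [one_zpow, one_mul, ← zpow_natCast q 4, ← zpow_mul]
    congr 1; push_cast; ring

lemma exp_zpow (x : ℂ) (n : ℤ) : Complex.exp x ^ n = Complex.exp (n * x) := (Complex.exp_int_mul x n).symm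

lemma I_eq_exp : I = Complex.exp (Real.pi * I / 2) := by
  have h : (Real.pi * I / 2 : ℂ) = Real.pi / 2 * I := by ring
  rw [h, Complex.exp_pi_div_two_mul_I]

lemma neg_one_eq_exp : (-1 : ℂ) = Complex.exp (Real.pi * I) := Complex.exp_pi_mul_I.symm

lemma term_eq (n : ℤ) (τ : ℂ) : jacobiTheta₂_term n (1 / 4 + τ / 4) τ =
    I ^ n * Complex.exp (Real.pi * I * τ / 2) ^ (2 * n ^ 2 + n) := by
  rw [jacobiTheta₂_term, exp_zpow, I_eq_exp, exp_zpow, ← Complex.exp_add, ← I_eq_exp]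
  congr 1; push_cast; ring

lemma theta_eq (z τ : ℂ) : jacobiThetaChar (1 / 4) (1 / 4) z τ =
    Complex.exp (Real.pi * I * τ / 16 + Real.pi * I / 2 * (z + 1 / 4)) *
      jacobiTheta₂ (z + (1 / 4 + τ / 4)) τ := by
  rw [jacobiThetaChar, jacobiTheta₂, ← tsum_mul_left]
  refine tsum_congr fun n => ?_
  rw [jacobiTheta₂_term, ← Complex.exp_add]
  congr 1; push_cast; ring

lemma theta_zero (τ : ℂ) : jacobiThetaChar (1 / 4) (1 / 4) 0 τ =
    Complex.exp (Real.pi * I * τ / 16 + Real.pi * I / 8) * P I (Complex.exp (Real.pi * I * τ / 2)) := by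
  rw [theta_eq, zero_add, zero_add, jacobiTheta₂, P]
  simp only [term_eq]
  congr 2; ring

lemma theta_deriv (τ : ℂ) (hτ : 0 < τ.im) : jacobiThetaCharDeriv (1 / 4) (1 / 4) τ =
    Complex.exp (Real.pi * I * τ / 16 + Real.pi * I / 8) * (Real.pi * I / 2) *
      E I (Complex.exp (Real.pi * I * τ / 2)) := by
  have h1 : HasDerivAt (fun z : ℂ => jacobiTheta₂ (z + (1 / 4 + τ / 4)) τ)
      (jacobiTheta₂' (1 / 4 + τ / 4) τ) 0 := by
    have := hasDerivAt_jacobiTheta₂_fst (0 + (1 / 4 + τ / 4)) hτ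
    have := this.comp_add_const 0 (1 / 4 + τ / 4)
    rwa [zero_add] at this
  have h2 : HasDerivAt (fun z : ℂ => Complex.exp (Real.pi * I * τ / 16 + Real.pi * I / 2 * (z + 1 / 4)))
      (Complex.exp (Real.pi * I * τ / 16 + Real.pi * I / 2 * (0 + 1 / 4)) * (Real.pi * I / 2 * 1)) 0 :=
    ((((hasDerivAt_id (0:ℂ)).add_const (1 / 4)).const_mul (Real.pi * I / 2)).const_add
      (Real.pi * I * τ / 16)).cexp
  have h3 := (h2.mul h1).deriv
  have h4 : (fun z => jacobiThetaChar (1 / 4) (1 / 4) z τ) = (fun z : ℂ =>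
    Complex.exp (Real.pi * I * τ / 16 + Real.pi * I / 2 * (z + 1 / 4))) *
      (fun z : ℂ => jacobiTheta₂ (z + (1 / 4 + τ / 4)) τ) := funext fun z => theta_eq z τ
  rw [jacobiThetaCharDeriv, h4, h3]
  have h5 : (Real.pi * I / 2) * E I (Complex.exp (Real.pi * I * τ / 2)) =
      (Real.pi * I / 2) * jacobiTheta₂ (1 / 4 + τ / 4) τ + jacobiTheta₂' (1 / 4 + τ / 4) τ := by
    have a := (hasSum_jacobiTheta₂_term (1 / 4 + τ / 4) hτ).mul_left (Real.pi * I / 2)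
    have b := hasSum_jacobiTheta₂'_term (1 / 4 + τ / 4) hτ
    rw [← (a.add b).tsum_eq, E, ← tsum_mul_left]
    refine tsum_congr fun n => ?_
    have h7 : jacobiTheta₂'_term n (1 / 4 + τ / 4) τ =
      2 * Real.pi * I * n * jacobiTheta₂_term n (1 / 4 + τ / 4) τ := rfl
    rw [h7, term_eq]
    ring
  have h6 : (Real.pi * I * τ / 16 + Real.pi * I / 2 * (0 + 1 / 4) : ℂ) =
    Real.pi * I * τ / 16 + Real.pi * I / 8 := by ring
  rw [h6, zero_add]
  linear_combination (-Complex.exp (Real.pi * I * τ / 16 + Real.pi * I / 8)) * h5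

lemma theta3 (τ : ℂ) : jacobiThetaChar 0 0 0 τ = F (Complex.exp (Real.pi * I * τ / 2) ^ 2) := by
  refine tsum_congr fun n => ?_
  rw [← Complex.exp_nat_mul, exp_zpow]
  congr 1; push_cast; ring

lemma theta4 (τ : ℂ) : jacobiThetaChar 0 (1 / 2) 0 τ = F (-Complex.exp (Real.pi * I * τ / 2) ^ 2) := by
  rw [F_neg']
  refine tsum_congr fun n => ?_
  rw [← Complex.exp_nat_mul, exp_zpow, neg_one_eq_exp, exp_zpow, ← Complex.exp_add]
  congr 1; push_cast; ring

lemma theta2 (τ : ℂ) : jacobiThetaChar (1 / 2) 0 0 τ = Complex.exp (Real.pi * I * τ / 4) *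
    ∑' n : ℤ, Complex.exp (Real.pi * I * τ / 2) ^ (2 * n ^ 2 + 2 * n) := by
  rw [← tsum_mul_left]
  refine tsum_congr fun n => ?_
  rw [exp_zpow, ← Complex.exp_add]
  congr 1; push_cast; ring

end ThetaQ

open ThetaQ

/-- `θ'[1/4;1/4](0,τ) · θ[1/4;1/4](0,τ)³ = −(π/4) θ[0;0](0,τ)⁴ θ[0;1/2](0,τ) θ[1/2;0](0,τ)`. -/
theorem theta_derivative_quarter_quarter (τ : ℂ) (hτ : 0 < τ.im) :
    jacobiThetaCharDeriv (1 / 4) (1 / 4) τ * jacobiThetaChar (1 / 4) (1 / 4) 0 τ ^ 3 =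
      -((Real.pi : ℂ) / 4) * jacobiThetaChar 0 0 0 τ ^ 4 *
        jacobiThetaChar 0 (1 / 2) 0 τ * jacobiThetaChar (1 / 2) 0 0 τ := by
  have hq0 : Complex.exp (Real.pi * I * τ / 2) ≠ 0 := Complex.exp_ne_zero _
  have hq : ‖Complex.exp (Real.pi * I * τ / 2)‖ < 1 := by
    rw [Complex.norm_exp, Real.exp_lt_one_iff]
    have : (Real.pi * I * τ / 2 : ℂ).re = -(Real.pi * τ.im / 2) := by
      have : (Real.pi * I * τ / 2 : ℂ) = ((Real.pi / 2 : ℝ) : ℂ) * (I * τ) := by push_cast; ring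
      rw [this, Complex.re_ofReal_mul]; simp; ring
    rw [this]
    have := Real.pi_pos
    have : 0 < Real.pi * τ.im / 2 := by positivity
    linarith
  have hc : Complex.exp (Real.pi * I * τ / 16 + Real.pi * I / 8) ^ 4 =
      Complex.exp (Real.pi * I * τ / 4) * I := by
    rw [I_eq_exp, ← Complex.exp_nat_mul, ← Complex.exp_add, ← I_eq_exp]
    congr 1; push_cast; ring
  rw [theta_zero, theta_deriv τ hτ, theta3, theta4, theta2, P_tail hq0 hq]
  have hm := main hq0 hq
  generalize Complex.exp (Real.pi * I * τ / 2) = q at *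
  generalize Complex.exp (Real.pi * I * τ / 16 + Real.pi * I / 8) = c at *
  have hI := I_sq
  linear_combination (Real.pi * I / 2 * (E I q * P I q ^ 3)) * hc
    + (Real.pi / 2 * Complex.exp (Real.pi * I * τ / 4) * (E I q * P I q ^ 3)) * hI
    - (Real.pi / 2 * Complex.exp (Real.pi * I * τ / 4)) * hm
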